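/- arXiv:2507.08725 — 7 statements merged into one kernel-verified Lean document; each statement's English description precedes it below -/
import Mathlib

section
/- For every single-processor instance with Σ_{i=1}^{n} ω(v_i) ≤ T (so that a feasible schedule exists), there exists an E-schedule that is optimal; that is, there is an E-schedule σ* with CC(σ*) ≤ CC(σ) for every feasible schedule σ. -/
/-!
Single-processor carbon-aware scheduling: there always exists an optimal `E`-schedule.

Tasks are indexed `0, …, n-1` (executed in this order), with durations `ω i`.
Interval boundaries are `bnd 0 = 0 < bnd 1 < … < bnd J = T`, interval `I_j = [bnd j, bnd (j+1))`
has green budget `𝒢 j`, and `G t` is the green budget at time unit `t`.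
-/

/-- A feasible schedule: tasks are executed in order without overlap,
and the last task completes by the deadline `T`. -/
def Feasible (n T : ℕ) (ω : ℕ → ℕ) (σ : ℕ → ℕ) : Prop :=
  (∀ i, i + 1 < n → σ i + ω i ≤ σ (i + 1)) ∧ (0 < n → σ (n - 1) + ω (n - 1) ≤ T)

/-- The processor is active at time unit `t`. -/
def Active (n : ℕ) (ω : ℕ → ℕ) (σ : ℕ → ℕ) (t : ℕ) : Prop :=
  ∃ i < n, σ i ≤ t ∧ t < σ i + ω i

/-- Power consumed at time unit `t`. -/
noncomputable def Power (n : ℕ) (ω : ℕ → ℕ) (Pidle Pwork : ℕ) (σ : ℕ → ℕ) (t : ℕ) : ℕ :=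
  @ite ℕ (Active n ω σ t) (Classical.propDecidable _) (Pidle + Pwork) Pidle

/-- Carbon cost of a schedule: `∑_{t<T} max(P(t) - G(t), 0)`
(truncated subtraction on `ℕ` is exactly `max(· - ·, 0)`). -/
noncomputable def CC (n T : ℕ) (ω : ℕ → ℕ) (Pidle Pwork : ℕ) (G : ℕ → ℕ) (σ : ℕ → ℕ) : ℕ :=
  ∑ t ∈ Finset.range T, (Power n ω Pidle Pwork σ t - G t)

/-- `v_r, …, v_s` form a block of σ: a maximal run of back-to-back tasks. -/
def IsBlock (n : ℕ) (ω : ℕ → ℕ) (σ : ℕ → ℕ) (r s : ℕ) : Prop :=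
  r ≤ s ∧ s < n ∧
  (∀ i, r ≤ i → i < s → σ (i + 1) = σ i + ω i) ∧
  (r = 0 ∨ σ (r - 1) + ω (r - 1) < σ r) ∧
  (s = n - 1 ∨ σ s + ω s < σ (s + 1))

/-- The set `E` of interval boundaries. -/
def ESet (J : ℕ) (bnd : ℕ → ℕ) : Set ℕ :=
  {e | ∃ j ≤ J, bnd j = e}

/-- An `E`-schedule: a feasible schedule each of whose blocks starts or ends
at an interval boundary. -/
def ESchedule (n T J : ℕ) (ω : ℕ → ℕ) (bnd : ℕ → ℕ) (σ : ℕ → ℕ) : Prop :=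
  Feasible n T ω σ ∧
  ∀ r s, IsBlock n ω σ r s → σ r ∈ ESet J bnd ∨ σ s + ω s ∈ ESet J bnd

/-- The additional carbon cost of being active at a time unit with green budget `g`. -/
def workCost (Pidle Pwork g : ℕ) : ℤ :=
  ((Pidle + Pwork - g : ℕ) : ℤ) - ((Pidle - g : ℕ) : ℤ)

theorem Feasible.end_le_start {n T : ℕ} {ω σ : ℕ → ℕ} (h : Feasible n T ω σ)
    {i j : ℕ} (hij : i < j) (hj : j < n) : σ i + ω i ≤ σ j := by
  induction j, hij using Nat.le_induction with
  | base => exact h.1 i hj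
  | succ k hk ih =>
    have h₁ := ih (by omega)
    have h₂ := h.1 k hj
    omega

theorem Feasible.end_le_deadline {n T : ℕ} {ω σ : ℕ → ℕ} (h : Feasible n T ω σ)
    {i : ℕ} (hi : i < n) : σ i + ω i ≤ T := by
  have h₁ := h.2 (by omega)
  rcases Nat.lt_or_ge i (n - 1) with h₂ | h₂
  · have h₃ := h.end_le_start h₂ (by omega)
    omega
  · obtain rfl : i = n - 1 := by omega
    exact h₁

theorem feasible_sum_range {n T : ℕ} {ω : ℕ → ℕ} (hfit : ∑ i ∈ Finset.range n, ω i ≤ T) :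
    Feasible n T ω fun i => ∑ k ∈ Finset.range i, ω k := by
  refine ⟨fun i _ => (Finset.sum_range_succ ω i).ge, fun hn => ?_⟩
  rw [← Finset.sum_range_succ, Nat.sub_add_cancel hn]
  exact hfit

theorem power_sub_eq {n T : ℕ} {ω σ : ℕ → ℕ} (h : Feasible n T ω σ) (Pidle Pwork t g : ℕ) :
    ((Power n ω Pidle Pwork σ t - g : ℕ) : ℤ) = ((Pidle - g : ℕ) : ℤ) +
      ∑ i ∈ Finset.range n, if t ∈ Finset.Ico (σ i) (σ i + ω i)
        then workCost Pidle Pwork g else 0 := by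
  unfold Power
  split_ifs with hA
  · obtain ⟨i, hi, h₁, h₂⟩ := hA
    rw [Finset.sum_eq_single i]
    · rw [if_pos (Finset.mem_Ico.2 ⟨h₁, h₂⟩), workCost]
      ring
    · intro j hj hji
      rw [if_neg]
      rw [Finset.mem_range] at hj
      rw [Finset.mem_Ico]
      rcases Nat.lt_or_gt_of_ne hji with hlt | hlt
      · have := h.end_le_start hlt hi
        omega
      · have := h.end_le_start hlt hj
        omega
    · intro hi'
      exact absurd (Finset.mem_range.2 hi) hi'
  · rw [Finset.sum_eq_zero, add_zero]
    intro i hi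
    rw [if_neg]
    exact fun hmem => hA ⟨i, Finset.mem_range.1 hi, Finset.mem_Ico.1 hmem⟩

/-- The carbon cost is the idle cost plus the additional cost of each task. -/
theorem CC_eq {n T : ℕ} {ω σ : ℕ → ℕ} (h : Feasible n T ω σ) (Pidle Pwork : ℕ) (G : ℕ → ℕ) :
    (CC n T ω Pidle Pwork G σ : ℤ) = ∑ t ∈ Finset.range T, ((Pidle - G t : ℕ) : ℤ) +
      ∑ i ∈ Finset.range n, ∑ t ∈ Finset.Ico (σ i) (σ i + ω i), workCost Pidle Pwork (G t) := by
  unfold CC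
  rw [Nat.cast_sum, Finset.sum_congr rfl fun t _ => power_sub_eq h Pidle Pwork t (G t),
    Finset.sum_add_distrib, Finset.sum_comm]
  congr 1
  refine Finset.sum_congr rfl fun i hi => ?_
  rw [Finset.sum_ite_mem]
  congr 1
  have := h.end_le_deadline (Finset.mem_range.1 hi)
  ext t
  simp only [Finset.mem_inter, Finset.mem_range, Finset.mem_Ico]
  omega

theorem sum_Icc_sum_Ico_eq {ω σ : ℕ → ℕ} {r s : ℕ} (hrs : r ≤ s)
    (hc : ∀ i, r ≤ i → i < s → σ (i + 1) = σ i + ω i) (c : ℕ → ℤ) :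
    σ r ≤ σ s ∧ ∑ i ∈ Finset.Icc r s, ∑ t ∈ Finset.Ico (σ i) (σ i + ω i), c t =
      ∑ t ∈ Finset.Ico (σ r) (σ s + ω s), c t := by
  induction s, hrs using Nat.le_induction with
  | base => simp
  | succ s hrs ih =>
    obtain ⟨hle, hsum⟩ := ih fun i h₁ h₂ => hc i h₁ (by omega)
    have hs := hc s hrs (by omega)
    refine ⟨by omega, ?_⟩
    rw [Finset.sum_Icc_succ_top (by omega), hsum, ← hs]
    exact Finset.sum_Ico_consecutive c (by omega) (by omega)

/-- Rescheduling a contiguous run of tasks as another contiguous run only changes the cost of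
the time window occupied by that run. -/
theorem CC_sub_CC_eq {n T : ℕ} {ω σ τ : ℕ → ℕ} (hσ : Feasible n T ω σ) (hτ : Feasible n T ω τ)
    {r s : ℕ} (hrs : r ≤ s) (hs : s < n)
    (hcσ : ∀ i, r ≤ i → i < s → σ (i + 1) = σ i + ω i)
    (hcτ : ∀ i, r ≤ i → i < s → τ (i + 1) = τ i + ω i)
    (heq : ∀ i, i < r ∨ s < i → τ i = σ i) (Pidle Pwork : ℕ) (G : ℕ → ℕ) :
    (CC n T ω Pidle Pwork G τ : ℤ) - CC n T ω Pidle Pwork G σ =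
      ∑ t ∈ Finset.Ico (τ r) (τ s + ω s), workCost Pidle Pwork (G t) -
      ∑ t ∈ Finset.Ico (σ r) (σ s + ω s), workCost Pidle Pwork (G t) := by
  rw [CC_eq hσ, CC_eq hτ, add_sub_add_left_eq_sub, ← (sum_Icc_sum_Ico_eq hrs hcσ _).2,
    ← (sum_Icc_sum_Ico_eq hrs hcτ _).2, ← Finset.sum_sub_distrib, ← Finset.sum_sub_distrib]
  symm
  apply Finset.sum_subset
  · intro i hi
    simp only [Finset.mem_Icc, Finset.mem_range] at *
    omega
  · intro i _ hi
    rw [heq i (by simp only [Finset.mem_Icc] at hi; omega), sub_self]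

theorem exists_interval {J t : ℕ} {bnd : ℕ → ℕ} (h0 : bnd 0 = 0) (ht : t < bnd J) :
    ∃ j < J, bnd j ≤ t ∧ t < bnd (j + 1) := by
  induction J with
  | zero => omega
  | succ J ih =>
    rcases Nat.lt_or_ge t (bnd J) with h | h
    · obtain ⟨j, hj, h₁⟩ := ih h
      exact ⟨j, by omega, h₁⟩
    · exact ⟨J, by omega, h, ht⟩

/-- The green budget does not change at a time that is not an interval boundary. -/
theorem budget_succ_eq {J t : ℕ} {bnd 𝒢 G : ℕ → ℕ} (h0 : bnd 0 = 0)
    (hG : ∀ j, j < J → ∀ t, bnd j ≤ t → t < bnd (j + 1) → G t = 𝒢 j)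
    (ht : t + 1 < bnd J) (hE : t + 1 ∉ ESet J bnd) : G (t + 1) = G t := by
  obtain ⟨j, hj, h₁, h₂⟩ := exists_interval h0 ht
  have hne : bnd j ≠ t + 1 := fun h => hE ⟨j, hj.le, h⟩
  rw [hG j hj _ h₁ h₂, hG j hj t (by omega) (by omega)]

theorem exists_minimizer {α : Type*} {p : α → Prop} (f : α → ℕ) (h : ∃ x, p x) :
    ∃ x, p x ∧ ∀ y, p y → f x ≤ f y := by
  obtain ⟨x, hx, hmin⟩ := WellFounded.has_min (measure f).wf {x | p x} h
  exact ⟨x, hx, fun y hy => not_lt.1 (hmin y hy)⟩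

theorem Feasible.advance_block {n T : ℕ} {ω σ : ℕ → ℕ} (h : Feasible n T ω σ) {r s : ℕ}
    (hb : IsBlock n ω σ r s) (hr : 0 < σ r) :
    Feasible n T ω fun i => if r ≤ i ∧ i ≤ s then σ i - 1 else σ i := by
  obtain ⟨hrs, hs, hc, hl, -⟩ := hb
  have hpos : ∀ i, r ≤ i → i ≤ s → 0 < σ i := by
    intro i h₁ h₂
    rcases h₁.eq_or_lt with rfl | h₁
    · exact hr
    · have := h.end_le_start h₁ (by omega)
      omega
  constructor
  · intro i hi
    have h₁ := h.1 i hi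
    have h₂ := hpos i
    have h₃ : r = i + 1 → σ i + ω i < σ (i + 1) := by
      rintro rfl
      simpa using hl
    dsimp only
    split_ifs <;> grind
  · intro hn
    have h₁ := h.2 hn
    dsimp only
    split_ifs <;> omega

theorem Feasible.delay_block {n T : ℕ} {ω σ : ℕ → ℕ} (h : Feasible n T ω σ) {r s : ℕ}
    (hb : IsBlock n ω σ r s) (hT : σ s + ω s < T) :
    Feasible n T ω fun i => if r ≤ i ∧ i ≤ s then σ i + 1 else σ i := by
  obtain ⟨hrs, hs, hc, -, hu⟩ := hb
  constructor
  · intro i hi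
    have h₁ := h.1 i hi
    have h₂ : i = s → σ i + ω i < σ (i + 1) := by
      rintro rfl
      omega
    dsimp only
    split_ifs <;> omega
  · intro hn
    have h₁ := h.2 hn
    have h₂ : n - 1 ≤ s → σ (n - 1) + ω (n - 1) < T := by
      intro h₂
      obtain rfl : s = n - 1 := by omega
      exact hT
    dsimp only
    split_ifs <;> omega

theorem sum_Ico_shift {a b : ℕ} (hab : a ≤ b) (c : ℕ → ℤ) :
    ∑ t ∈ Finset.Ico (a + 1) (b + 1), c t = ∑ t ∈ Finset.Ico a b, c t + c b - c a := by
  rw [Finset.sum_Ico_eq_sub _ (by omega), Finset.sum_Ico_eq_sub _ hab, Finset.sum_range_succ,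
    Finset.sum_range_succ]
  ring

/-- With a single processor, there always exists an optimal `E`-schedule. -/
theorem exists_optimal_ESchedule
    (n T J : ℕ) (ω : ℕ → ℕ) (bnd : ℕ → ℕ) (𝒢 : ℕ → ℕ) (G : ℕ → ℕ) (Pidle Pwork : ℕ)
    (hω : ∀ i, i < n → 0 < ω i)
    (hbnd0 : bnd 0 = 0) (hbndJ : bnd J = T)
    (hmono : ∀ j, j < J → bnd j < bnd (j + 1))
    (hG : ∀ j, j < J → ∀ t, bnd j ≤ t → t < bnd (j + 1) → G t = 𝒢 j)
    (hfit : ∑ i ∈ Finset.range n, ω i ≤ T) :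
    ∃ σstar : ℕ → ℕ, ESchedule n T J ω bnd σstar ∧
      ∀ σ : ℕ → ℕ, Feasible n T ω σ →
        CC n T ω Pidle Pwork G σstar ≤ CC n T ω Pidle Pwork G σ := by
  obtain ⟨σ₀, hσ₀, hmin₀⟩ := exists_minimizer (CC n T ω Pidle Pwork G)
    ⟨_, feasible_sum_range hfit⟩
  -- Among the optimal schedules, take one with minimal sum of start times.
  obtain ⟨σ, ⟨hσ, hopt⟩, hmin⟩ := exists_minimizer
    (p := fun σ => Feasible n T ω σ ∧
      ∀ τ, Feasible n T ω τ → CC n T ω Pidle Pwork G σ ≤ CC n T ω Pidle Pwork G τ)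
    (fun σ => ∑ i ∈ Finset.range n, σ i) ⟨σ₀, hσ₀, hmin₀⟩
  refine ⟨σ, ⟨hσ, fun r s hb => ?_⟩, hopt⟩
  by_contra! hE
  obtain ⟨hr, hs⟩ := hE
  obtain ⟨hrs, hsn, hc, -, -⟩ := id hb
  have hle := (sum_Icc_sum_Ico_eq hrs hc 0).1
  have hr0 : 0 < σ r := by
    exact Nat.pos_of_ne_zero fun h => hr ⟨0, by omega, by omega⟩
  have hsT : σ s + ω s < T := by
    exact lt_of_le_of_ne (hσ.end_le_deadline hsn) fun h => hs ⟨J, le_rfl, by omega⟩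
  obtain ⟨a, ha⟩ : ∃ a, σ r = a + 1 := ⟨σ r - 1, by omega⟩
  obtain ⟨b, hsb⟩ : ∃ b, σ s + ω s = b + 1 := ⟨σ s + ω s - 1, by omega⟩
  have hGa : G (a + 1) = G a := budget_succ_eq hbnd0 hG (by omega) (ha ▸ hr)
  have hGb : G (b + 1) = G b := budget_succ_eq hbnd0 hG (by omega) (hsb ▸ hs)
  have hadv := hσ.advance_block hb hr0
  have hdel := hσ.delay_block hb hsT
  have hposi : ∀ i, r ≤ i → i ≤ s → 0 < σ i := by
    intro i h₁ h₂
    have := (sum_Icc_sum_Ico_eq h₁ (fun k hk hk' => hc k hk (by omega)) 0).1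
    omega
  have hCadv := CC_sub_CC_eq hσ hadv hrs hsn hc
    (by
      intro i h₁ h₂
      have := hc i h₁ h₂
      have := hposi i h₁ h₂.le
      rw [if_pos (by omega), if_pos (by omega)]
      omega)
    (fun i hi => if_neg (by omega)) Pidle Pwork G
  have hCdel := CC_sub_CC_eq hσ hdel hrs hsn hc
    (by
      intro i h₁ h₂
      have := hc i h₁ h₂
      rw [if_pos (by omega), if_pos (by omega)]
      omega)
    (fun i hi => if_neg (by omega)) Pidle Pwork G
  have hposs := hposi s hrs le_rfl
  simp only [le_refl, hrs, and_self, if_true] at hCadv hCdel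
  rw [ha, hsb, show σ s - 1 + ω s = b by omega, Nat.add_sub_cancel,
    sum_Ico_shift (by omega)] at hCadv
  rw [ha, show σ s + 1 + ω s = b + 1 + 1 by omega, hsb, sum_Ico_shift (by omega), hGa, hGb]
    at hCdel
  have hoadv := hopt _ hadv
  have hodel := hopt _ hdel
  have hlt := hmin _ ⟨hadv, fun τ hτ => le_trans (by omega) (hopt τ hτ)⟩
  refine absurd hlt (not_le.2 (Finset.sum_lt_sum (fun i _ => ?_) ⟨s, by simpa using hsn, ?_⟩))
  · split_ifs <;> omega
  · rw [if_pos ⟨hrs, le_rfl⟩]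
    omega
end

section
/- For every 2 ≤ i ≤ n and every t with Σ_{k=1}^{i} ω(v_k) ≤ t ≤ T, the dynamic-programming recurrence holds: Opt(i, t) = cc(v_i, t) + min{ Opt(i−1, s) : Σ_{k=1}^{i−1} ω(v_k) ≤ s ≤ t − ω(v_i) }. -/
/-!
Single-processor carbon-aware scheduling: the dynamic-programming recurrence
`Opt(i, t) = cc(v_i, t) + min { Opt(i-1, s) : Σ_{k<i-1} ω ≤ s ≤ t - ω(v_i) }`.

Tasks are `0`-indexed internally: the `i`-th task of the paper (`1 ≤ i ≤ n`)
has duration `ω (i-1)`, and `Opt i t` concerns the first `i` tasks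
`ω 0, …, ω (i-1)`.
-/

/-- Incremental cost of executing task `i` so that it ends at time `t`. -/
def cc (ω : ℕ → ℕ) (Pidle Pwork : ℕ) (G : ℕ → ℕ) (i t : ℕ) : ℕ :=
  ∑ s ∈ Finset.Ico (t - ω i) t, ((Pidle + Pwork - G s) - (Pidle - G s))

/-- `Opt i t`: minimal total incremental cost of a partial schedule of the first
`i` tasks in which task `i - 1` completes exactly at time `t`. -/
noncomputable def Opt (ω : ℕ → ℕ) (Pidle Pwork : ℕ) (G : ℕ → ℕ) (i t : ℕ) : ℕ :=
  sInf {c | ∃ τ : ℕ → ℕ,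
    (∀ j, j + 1 < i → τ j + ω j ≤ τ (j + 1)) ∧
    τ (i - 1) + ω (i - 1) = t ∧
    c = ∑ j ∈ Finset.range i, cc ω Pidle Pwork G j (τ j + ω j)}

/-- In a partial schedule, every task ends no earlier than the total duration of the tasks up to
and including it. -/
theorem sum_range_succ_le_completion {ω τ : ℕ → ℕ} {i : ℕ}
    (h : ∀ j, j + 1 < i → τ j + ω j ≤ τ (j + 1)) (j : ℕ) (hj : j < i) :
    ∑ k ∈ Finset.range (j + 1), ω k ≤ τ j + ω j := by
  induction j with
  | zero => simp
  | succ j ih =>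
    rw [Finset.sum_range_succ]
    have h₁ := ih (by omega)
    have h₂ := h j hj
    omega

/-- The optimum is a lower bound for the cost of every partial schedule. -/
theorem Opt_le_cost {ω : ℕ → ℕ} (Pidle Pwork : ℕ) (G : ℕ → ℕ) {m t : ℕ} {τ : ℕ → ℕ}
    (h : ∀ j, j + 1 < m + 1 → τ j + ω j ≤ τ (j + 1)) (ht : τ m + ω m = t) :
    Opt ω Pidle Pwork G (m + 1) t ≤
      ∑ j ∈ Finset.range (m + 1), cc ω Pidle Pwork G j (τ j + ω j) :=
  Nat.sInf_le ⟨τ, h, ht, rfl⟩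

/-- If the tasks fit before `t`, the optimum is attained by a partial schedule. -/
theorem exists_schedule_cost_eq_Opt (ω : ℕ → ℕ) (Pidle Pwork : ℕ) (G : ℕ → ℕ) {m t : ℕ}
    (ht : ∑ k ∈ Finset.range (m + 1), ω k ≤ t) :
    ∃ τ : ℕ → ℕ, (∀ j, j + 1 < m + 1 → τ j + ω j ≤ τ (j + 1)) ∧ τ m + ω m = t ∧
      Opt ω Pidle Pwork G (m + 1) t =
        ∑ j ∈ Finset.range (m + 1), cc ω Pidle Pwork G j (τ j + ω j) := by
  rw [Finset.sum_range_succ] at ht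
  refine Nat.sInf_mem (s := {c | ∃ τ : ℕ → ℕ, (∀ j, j + 1 < m + 1 → τ j + ω j ≤ τ (j + 1)) ∧
    τ m + ω m = t ∧ c = ∑ j ∈ Finset.range (m + 1), cc ω Pidle Pwork G j (τ j + ω j)})
    ⟨_, fun j => if j = m then t - ω m else ∑ k ∈ Finset.range j, ω k, ?_, ?_, rfl⟩
  · intro j hj
    have hjm : j ≠ m := by omega
    simp only [if_neg hjm, ← Finset.sum_range_succ]
    split_ifs with h
    · rw [h]
      omega
    · exact le_rfl
  · simp only [if_true]
    omega

/-- The dynamic-programming recurrence, for `2 ≤ i ≤ n` and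
`Σ_{k=1}^{i} ω(v_k) ≤ t ≤ T`. -/
theorem Opt_recurrence
    (n T J : ℕ) (ω : ℕ → ℕ) (bnd : ℕ → ℕ) (𝒢 : ℕ → ℕ) (G : ℕ → ℕ) (Pidle Pwork : ℕ)
    (hω : ∀ i, i < n → 0 < ω i)
    (hbnd0 : bnd 0 = 0) (hbndJ : bnd J = T)
    (hmono : ∀ j, j < J → bnd j < bnd (j + 1))
    (hG : ∀ j, j < J → ∀ t, bnd j ≤ t → t < bnd (j + 1) → G t = 𝒢 j)
    (i t : ℕ) (hi2 : 2 ≤ i) (hin : i ≤ n)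
    (ht1 : ∑ k ∈ Finset.range i, ω k ≤ t) (ht2 : t ≤ T) :
    Opt ω Pidle Pwork G i t =
      cc ω Pidle Pwork G (i - 1) t +
        sInf {c | ∃ s, (∑ k ∈ Finset.range (i - 1), ω k) ≤ s ∧ s ≤ t - ω (i - 1) ∧
          c = Opt ω Pidle Pwork G (i - 1) s} := by
  obtain ⟨m, rfl⟩ : ∃ m, i = m + 2 := ⟨i - 2, by omega⟩
  simp only [show m + 2 - 1 = m + 1 from rfl]
  have hsum := ht1
  rw [Finset.sum_range_succ] at hsum
  apply le_antisymm
  · obtain ⟨s, hs₁, hs₂, hs⟩ := Nat.sInf_mem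
      (s := {c | ∃ s, (∑ k ∈ Finset.range (m + 1), ω k) ≤ s ∧ s ≤ t - ω (m + 1) ∧
        c = Opt ω Pidle Pwork G (m + 1) s})
      ⟨_, ∑ k ∈ Finset.range (m + 1), ω k, le_rfl, by omega, rfl⟩
    obtain ⟨τ, hτ, hend, hcost⟩ := exists_schedule_cost_eq_Opt ω Pidle Pwork G hs₁
    rw [hs, hcost]
    have hne : ∀ j, j < m + 1 → Function.update τ (m + 1) (t - ω (m + 1)) j = τ j :=
      fun j hj => Function.update_of_ne (by omega) _ _
    have hlast : Function.update τ (m + 1) (t - ω (m + 1)) (m + 1) + ω (m + 1) = t := by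
      rw [Function.update_self]
      omega
    refine (Opt_le_cost Pidle Pwork G (τ := Function.update τ (m + 1) (t - ω (m + 1)))
      ?_ hlast).trans_eq ?_
    · intro j hj
      rw [hne j (by omega)]
      rcases Nat.lt_or_ge j m with hjm | hjm
      · rw [hne (j + 1) (by omega)]
        exact hτ j (by omega)
      · obtain rfl : j = m := by omega
        rw [Function.update_self]
        omega
    · rw [Finset.sum_range_succ, hlast, add_comm]
      congr 1
      refine Finset.sum_congr rfl fun j hj => ?_
      rw [hne j (Finset.mem_range.mp hj)]
  · obtain ⟨τ, hτ, hend, hcost⟩ := exists_schedule_cost_eq_Opt ω Pidle Pwork G ht1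
    rw [hcost, Finset.sum_range_succ _ (m + 1), hend, add_comm]
    refine Nat.add_le_add_right ?_ _
    refine le_trans ?_ (Opt_le_cost Pidle Pwork G (fun j hj => hτ j (by omega)) rfl)
    have hm := hτ m (by omega)
    exact Nat.sInf_le
      ⟨τ m + ω m, sum_range_succ_le_completion hτ m (by omega), by omega, rfl⟩
end

section
/- If x admits a 3-partition, then the associated UCAS instance has a schedule of carbon cost 0. In particular, executing the three tasks of the k-th triplet sequentially, starting at time (k−1)(B+1), yields such a schedule. -/
/-!
3-Partition ⟹ zero-cost UCAS schedule: executing the tasks of the `k`-th triplet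
sequentially inside the `k`-th green segment `[k(B+1), k(B+1)+B)` (segments
`0`-indexed here) yields a schedule of carbon cost `0`.
-/

/-- Horizon of the UCAS instance associated with a 3-Partition instance. -/
def ucasT (n B : ℕ) : ℕ := n * B + n - 1

/-- Green power budget at time unit `t`: `1` on green units, `0` on separators. -/
def green (B t : ℕ) : ℕ := if t % (B + 1) < B then 1 else 0

/-- σ is a valid schedule: every task completes by the horizon. -/
def IsSchedule (n B : ℕ) (x σ : Fin (3 * n) → ℕ) : Prop :=
  ∀ i, σ i + x i ≤ ucasT n B

/-- Number of tasks active at time unit `t`. -/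
def ActiveCount (n : ℕ) (x σ : Fin (3 * n) → ℕ) (t : ℕ) : ℕ :=
  (Finset.univ.filter fun i : Fin (3 * n) => σ i ≤ t ∧ t < σ i + x i).card

/-- Total carbon cost of σ: `∑_{t<T} max(A(t) - g(t), 0)`. -/
def carbonCost (n B : ℕ) (x σ : Fin (3 * n) → ℕ) : ℕ :=
  ∑ t ∈ Finset.range (ucasT n B), (ActiveCount n x σ t - green B t)

/-- `x` admits a 3-partition: a partition of the `3n` indices into `n` subsets,
each summing to `B`. -/
def ThreePartition (n B : ℕ) (x : Fin (3 * n) → ℕ) : Prop :=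
  ∃ S : Fin n → Finset (Fin (3 * n)),
    (∀ i, ∃! k, i ∈ S k) ∧ ∀ k, ∑ i ∈ S k, x i = B

/-- Total duration of the tasks of `s` that precede `i`: the start time of `i` when the tasks
of `s` are executed back to back from time `0` in increasing order. -/
def precedingLoad {ι : Type*} [LinearOrder ι] (x : ι → ℕ) (s : Finset ι) (i : ι) : ℕ :=
  ∑ j ∈ s with j < i, x j

theorem precedingLoad_add_le_sum {ι : Type*} [LinearOrder ι] (x : ι → ℕ) {s : Finset ι} {i : ι}
    (hi : i ∈ s) : precedingLoad x s i + x i ≤ ∑ j ∈ s, x j := by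
  rw [precedingLoad, add_comm, ← Finset.sum_insert (s := {j ∈ s | j < i}) (by simp)]
  apply Finset.sum_le_sum_of_subset
  grind

theorem precedingLoad_add_le_precedingLoad {ι : Type*} [LinearOrder ι] (x : ι → ℕ) {s : Finset ι}
    {i j : ι} (hi : i ∈ s) (hij : i < j) :
    precedingLoad x s i + x i ≤ precedingLoad x s j := by
  rw [precedingLoad, add_comm, ← Finset.sum_insert (s := {j ∈ s | j < i}) (by simp)]
  apply Finset.sum_le_sum_of_subset
  grind

theorem green_eq_one_of_mem_segment {B k t : ℕ} (h₁ : k * (B + 1) ≤ t)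
    (h₂ : t < k * (B + 1) + B) : green B t = 1 := by
  obtain ⟨r, rfl⟩ := Nat.exists_eq_add_of_le h₁
  have hr : r < B := by omega
  rw [green, add_comm, Nat.add_mul_mod_self_right, Nat.mod_eq_of_lt (by omega), if_pos hr]

theorem segment_index_eq {B k t : ℕ} (h₁ : k * (B + 1) ≤ t)
    (h₂ : t < k * (B + 1) + B) : t / (B + 1) = k :=
  Nat.div_eq_of_lt_le h₁ (by rw [add_mul]; omega)

theorem segment_end_le_ucasT {n B k : ℕ} (hk : k < n) :
    k * (B + 1) + B ≤ ucasT n B := by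
  have h : (k + 1) * (B + 1) ≤ n * (B + 1) := Nat.mul_le_mul_right _ hk
  rw [ucasT]
  rw [add_mul, mul_add n] at h
  omega

/-- If at most one task is active at any time, and every task runs inside a green segment, then
the schedule has carbon cost `0`. -/
theorem carbonCost_eq_zero {n B : ℕ} {x σ : Fin (3 * n) → ℕ}
    (hgreen : ∀ i t, σ i ≤ t → t < σ i + x i → green B t = 1)
    (hdisj : ∀ i j t, σ i ≤ t → t < σ i + x i → σ j ≤ t → t < σ j + x j → i = j) :
    carbonCost n B x σ = 0 := by
  refine Finset.sum_eq_zero fun t _ => Nat.sub_eq_zero_of_le ?_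
  rw [ActiveCount]
  by_cases h : ∃ i, σ i ≤ t ∧ t < σ i + x i
  · obtain ⟨i, hi⟩ := h
    rw [hgreen i t hi.1 hi.2, Finset.card_le_one]
    intro a ha b hb
    simp only [Finset.mem_filter, Finset.mem_univ, true_and] at ha hb
    exact hdisj a b t ha.1 ha.2 hb.1 hb.2
  · rw [Finset.filter_false_of_mem fun i _ hi => h ⟨i, hi⟩]
    simp

/-- If `x` admits a 3-partition (witnessed by `S`), the associated UCAS instance
has a schedule of carbon cost `0`; in particular there is such a schedule that
executes the tasks of the `k`-th part inside the `k`-th green segment. -/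
theorem threePartition_to_zero_cost_schedule
    (n B : ℕ) (hn : 0 < n) (hB : 0 < B) (x : Fin (3 * n) → ℕ)
    (hsum : ∑ i, x i = n * B)
    (hx : ∀ i, B < 4 * x i ∧ 2 * x i < B)
    (S : Fin n → Finset (Fin (3 * n)))
    (hpart : ∀ i, ∃! k, i ∈ S k) (hSsum : ∀ k, ∑ i ∈ S k, x i = B) :
    ∃ σ : Fin (3 * n) → ℕ, IsSchedule n B x σ ∧ carbonCost n B x σ = 0 ∧
      ∀ k : Fin n, ∀ i ∈ S k,
        (k : ℕ) * (B + 1) ≤ σ i ∧ σ i + x i ≤ (k : ℕ) * (B + 1) + B := by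
  choose κ hκ hκ_unique using hpart
  set σ : Fin (3 * n) → ℕ := fun i => κ i * (B + 1) + precedingLoad x (S (κ i)) i with hσ
  have hstart (i) : (κ i : ℕ) * (B + 1) ≤ σ i := Nat.le_add_right _ _
  have hend (i) : σ i + x i ≤ κ i * (B + 1) + B := by
    have := precedingLoad_add_le_sum x (hκ i)
    rw [hSsum] at this
    simp only [hσ]
    omega
  have horder {i j} (hk : κ i = κ j) (hij : i < j) : σ i + x i ≤ σ j := by
    have := precedingLoad_add_le_precedingLoad x (hκ i) hij
    simp only [hσ, ← hk]
    omega
  refine ⟨σ, fun i => (hend i).trans (segment_end_le_ucasT (κ i).isLt),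
    carbonCost_eq_zero ?_ ?_, ?_⟩
  · intro i t h₁ h₂
    exact green_eq_one_of_mem_segment ((hstart i).trans h₁) (h₂.trans_le (hend i))
  · intro i j t hi₁ hi₂ hj₁ hj₂
    have hk : κ i = κ j := Fin.ext <|
      (segment_index_eq ((hstart i).trans hi₁) (hi₂.trans_le (hend i))).symm.trans
        (segment_index_eq ((hstart j).trans hj₁) (hj₂.trans_le (hend j)))
    rcases lt_trichotomy i j with h | h | h
    · have := horder hk h
      omega
    · exact h
    · have := horder hk.symm h
      omega
  · intro k i hi
    obtain rfl := hκ_unique i k hi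
    exact ⟨hstart i, hend i⟩
end

section
/- If a schedule σ of the associated UCAS instance has carbon cost 0, then A(t) = g(t) for every 0 ≤ t < T; that is, exactly one task is active at every time unit t with t mod (B+1) < B, and no task is active at any time unit t with t mod (B+1) = B. -/
/-- The total green budget over `n` full periods is `n * B`. -/
theorem sum_green_range_mul (n B : ℕ) :
    ∑ t ∈ Finset.range (n * (B + 1)), green B t = n * B := by
  induction n with
  | zero => simp
  | succ n ih =>
    have hperiod : ∑ t ∈ Finset.range (B + 1), green B (n * (B + 1) + t) = B := by
      have hgreen : ∀ t ∈ Finset.range B, green B (n * (B + 1) + t) = 1 := by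
        intro t ht
        rw [Finset.mem_range] at ht
        rw [green, Nat.mul_add_mod', Nat.mod_eq_of_lt (by omega), if_pos ht]
      rw [Finset.sum_range_succ, Finset.sum_congr rfl hgreen]
      simp [green]
    rw [Nat.succ_mul, Finset.sum_range_add, ih, hperiod, Nat.succ_mul]

/-- The total green budget over the horizon is `n * B`. -/
theorem sum_green_range_ucasT {n : ℕ} (B : ℕ) (hn : 0 < n) :
    ∑ t ∈ Finset.range (ucasT n B), green B t = n * B := by
  have hT : n * (B + 1) = ucasT n B + 1 := by
    rw [ucasT, Nat.mul_succ]
    omega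
  have hlast : green B (ucasT n B) = 0 := by
    obtain ⟨m, rfl⟩ := Nat.exists_eq_add_one.mpr hn
    have hsep : ucasT (m + 1) B = m * (B + 1) + B := by
      rw [Nat.succ_mul] at hT
      omega
    simp [green, hsep]
  rw [← sum_green_range_mul, hT, Finset.sum_range_succ, hlast, add_zero]

/-- In a valid schedule, the active counts sum to the total duration of the tasks. -/
theorem IsSchedule.sum_activeCount {n B : ℕ} {x σ : Fin (3 * n) → ℕ}
    (hσ : IsSchedule n B x σ) :
    ∑ t ∈ Finset.range (ucasT n B), ActiveCount n x σ t = ∑ i, x i := by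
  simp only [ActiveCount, Finset.card_filter]
  rw [Finset.sum_comm]
  refine Finset.sum_congr rfl fun i _ => ?_
  rw [← Finset.card_filter]
  have hactive : (Finset.range (ucasT n B)).filter (fun t => σ i ≤ t ∧ t < σ i + x i) =
      Finset.Ico (σ i) (σ i + x i) := by
    ext t
    have := hσ i
    simp only [Finset.mem_filter, Finset.mem_range, Finset.mem_Ico]
    omega
  rw [hactive, Nat.card_Ico, Nat.add_sub_cancel_left]

/-- In a zero-cost schedule the number of active tasks never exceeds the green budget. -/
theorem activeCount_le_green {n B : ℕ} {x σ : Fin (3 * n) → ℕ}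
    (hcost : carbonCost n B x σ = 0) :
    ∀ t ∈ Finset.range (ucasT n B), ActiveCount n x σ t ≤ green B t := fun t ht =>
  Nat.sub_eq_zero_iff_le.mp (Finset.sum_eq_zero_iff.mp hcost t ht)

/-- A zero-cost schedule saturates the green budget: `A(t) = g(t)` for all `t < T`. -/
theorem zero_cost_schedule_saturates
    (n B : ℕ) (hn : 0 < n) (hB : 0 < B) (x : Fin (3 * n) → ℕ)
    (hsum : ∑ i, x i = n * B)
    (hx : ∀ i, B < 4 * x i ∧ 2 * x i < B)
    (σ : Fin (3 * n) → ℕ) (hσ : IsSchedule n B x σ)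
    (hcost : carbonCost n B x σ = 0) :
    ∀ t, t < ucasT n B → ActiveCount n x σ t = green B t := by
  intro t ht
  refine (Finset.sum_eq_sum_iff_of_le (activeCount_le_green hcost)).mp ?_ t
    (Finset.mem_range.mpr ht)
  rw [hσ.sum_activeCount, hsum, sum_green_range_ucasT B hn]
end

section
/- x admits a 3-partition if and only if the associated UCAS instance has a schedule of carbon cost 0. (This is the correctness of the reduction from 3-Partition underlying the strong NP-completeness of the carbon-aware scheduling problem with several processors.) -/
theorem carbonCost_eq_zero_iff {n B : ℕ} {x σ : Fin (3 * n) → ℕ} :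
    carbonCost n B x σ = 0 ↔ ∀ t < ucasT n B, ActiveCount n x σ t ≤ green B t := by
  simp [carbonCost, Finset.sum_eq_zero_iff, Nat.sub_eq_zero_iff_le]

theorem green_le_one (B t : ℕ) : green B t ≤ 1 := by
  unfold green; split <;> omega

theorem activeCount_pos {n : ℕ} {x σ : Fin (3 * n) → ℕ} {t : ℕ} {i : Fin (3 * n)}
    (h₁ : σ i ≤ t) (h₂ : t < σ i + x i) : 0 < ActiveCount n x σ t :=
  Finset.card_pos.mpr ⟨i, by simp [h₁, h₂]⟩

theorem eq_of_activeCount_le_one {n : ℕ} {x σ : Fin (3 * n) → ℕ} {t : ℕ}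
    (h : ActiveCount n x σ t ≤ 1) {i j : Fin (3 * n)}
    (hi : σ i ≤ t ∧ t < σ i + x i) (hj : σ j ≤ t ∧ t < σ j + x j) : i = j :=
  Finset.card_le_one.mp h i (by simp [hi]) j (by simp [hj])

theorem block_end_le_ucasT {n k : ℕ} (B : ℕ) (h : k < n) :
    k * (B + 1) + B ≤ ucasT n B := by
  have := Nat.mul_le_mul_right (B + 1) (Nat.succ_le_of_lt h)
  simp only [ucasT, Nat.succ_eq_add_one, add_mul, mul_add, one_mul, mul_one] at *
  omega

theorem div_lt_of_lt_ucasT {n B t : ℕ} (h : t < ucasT n B) : t / (B + 1) < n := by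
  rw [Nat.div_lt_iff_lt_mul (Nat.add_one_pos B), mul_add, mul_one]
  unfold ucasT at h
  omega

/-- Processing the tasks of each block in index order, back to back from the start of the block,
gives a zero-cost schedule. -/
theorem ThreePartition.exists_schedule {n B : ℕ} {x : Fin (3 * n) → ℕ}
    (h : ThreePartition n B x) :
    ∃ σ : Fin (3 * n) → ℕ, IsSchedule n B x σ ∧ carbonCost n B x σ = 0 := by
  obtain ⟨S, hS, hsum⟩ := h
  choose k hk _ using fun i => hS i
  let p : Fin (3 * n) → ℕ := fun i => ∑ j ∈ S (k i) with j < i, x j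
  have hp : ∀ i, p i + x i = ∑ j ∈ insert i {j ∈ S (k i) | j < i}, x j := fun i => by
    rw [Finset.sum_insert (by simp), add_comm]
  have hpB : ∀ i, p i + x i ≤ B := fun i => by
    rw [hp, ← hsum (k i)]
    exact Finset.sum_le_sum_of_subset (Finset.insert_subset (hk i) (Finset.filter_subset _ _))
  have hlt : ∀ i j, k i = k j → i < j → p i + x i ≤ p j := fun i j hij hlt => by
    rw [hp]
    refine Finset.sum_le_sum_of_subset fun a ha => ?_
    rw [Finset.mem_insert, Finset.mem_filter] at ha
    rw [Finset.mem_filter, ← hij]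
    rcases ha with rfl | ⟨ha, hai⟩
    exacts [⟨hk a, hlt⟩, ⟨ha, hai.trans hlt⟩]
  let σ : Fin (3 * n) → ℕ := fun i => k i * (B + 1) + p i
  have hactive : ∀ i t, σ i ≤ t → t < σ i + x i →
      t / (B + 1) = k i ∧ p i ≤ t % (B + 1) ∧ t % (B + 1) < p i + x i := fun i t h₁ h₂ => by
    have hB := hpB i
    have hd : t / (B + 1) = k i := by
      rw [Nat.div_eq_iff (Nat.add_one_pos B)]
      simp only [σ] at h₁ h₂
      omega
    have hm := Nat.div_add_mod' t (B + 1)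
    rw [hd] at hm
    simp only [σ] at h₁ h₂
    omega
  refine ⟨σ, fun i => ?_, carbonCost_eq_zero_iff.mpr fun t _ => ?_⟩
  · have := block_end_le_ucasT B (k i).isLt
    have := hpB i
    simp only [σ]
    omega
  · unfold green
    split_ifs with ht
    · refine Finset.card_le_one.mpr fun i hi j hj => ?_
      obtain ⟨-, hi₁, hi₂⟩ := Finset.mem_filter.mp hi
      obtain ⟨-, hj₁, hj₂⟩ := Finset.mem_filter.mp hj
      obtain ⟨hki, hi₁, hi₂⟩ := hactive i t hi₁ hi₂
      obtain ⟨hkj, hj₁, hj₂⟩ := hactive j t hj₁ hj₂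
      have hkij : k i = k j := Fin.ext (hki.symm.trans hkj)
      rcases lt_trichotomy i j with hij | hij | hij
      · have := hlt i j hkij hij
        omega
      · exact hij
      · have := hlt j i hkij.symm hij
        omega
    · refine (Finset.card_eq_zero.mpr (Finset.filter_eq_empty_iff.mpr ?_)).le
      rintro i - ⟨h₁, h₂⟩
      have := hactive i t h₁ h₂
      have := hpB i
      omega

/-- In a zero-cost schedule no task runs across a separator. -/
theorem mod_add_le_of_carbonCost_eq_zero {n B : ℕ} {x σ : Fin (3 * n) → ℕ}
    (hσ : IsSchedule n B x σ) (hc : carbonCost n B x σ = 0) (i : Fin (3 * n)) :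
    σ i % (B + 1) + x i ≤ B := by
  by_contra! hlt
  have hdiv := Nat.div_add_mod' (σ i) (B + 1)
  have hmod := Nat.mod_lt (σ i) (Nat.add_one_pos B)
  have h₁ : σ i ≤ σ i / (B + 1) * (B + 1) + B := by omega
  have h₂ : σ i / (B + 1) * (B + 1) + B < σ i + x i := by omega
  have hle := carbonCost_eq_zero_iff.mp hc _ (h₂.trans_le (hσ i))
  have hpos := activeCount_pos h₁ h₂
  have hg : green B (σ i / (B + 1) * (B + 1) + B) = 0 := by
    simp [green, Nat.mul_add_mod_self_right]
  omega

/-- In a zero-cost schedule the tasks started in a given block have total duration at most `B`. -/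
theorem sum_block_le {n B : ℕ} {x σ : Fin (3 * n) → ℕ}
    (hσ : IsSchedule n B x σ) (hc : carbonCost n B x σ = 0) (k : ℕ) :
    ∑ i with σ i / (B + 1) = k, x i ≤ B := by
  calc ∑ i with σ i / (B + 1) = k, x i
      = ∑ i with σ i / (B + 1) = k, (Finset.Ico (σ i) (σ i + x i)).card := by simp
    _ = (Finset.biUnion {i | σ i / (B + 1) = k} fun i => Finset.Ico (σ i) (σ i + x i)).card := by
        refine (Finset.card_biUnion fun i _ j _ hij => ?_).symm
        refine Finset.disjoint_left.mpr fun t hti htj => hij ?_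
        rw [Finset.mem_Ico] at hti htj
        exact eq_of_activeCount_le_one ((carbonCost_eq_zero_iff.mp hc t
          (hti.2.trans_le (hσ i))).trans (green_le_one B t)) hti htj
    _ ≤ (Finset.Ico (k * (B + 1)) (k * (B + 1) + B)).card := by
        refine Finset.card_le_card fun t ht => ?_
        simp only [Finset.mem_biUnion, Finset.mem_filter, Finset.mem_univ, true_and,
          Finset.mem_Ico] at ht ⊢
        obtain ⟨i, rfl, h₁, h₂⟩ := ht
        have := Nat.div_add_mod' (σ i) (B + 1)
        have := mod_add_le_of_carbonCost_eq_zero hσ hc i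
        omega
    _ = B := by simp

/-- The blocks of a zero-cost schedule form a 3-partition. -/
theorem threePartition_of_schedule {n B : ℕ} {x σ : Fin (3 * n) → ℕ}
    (hsum : ∑ i, x i = n * B) (hx : ∀ i, 0 < x i)
    (hσ : IsSchedule n B x σ) (hc : carbonCost n B x σ = 0) : ThreePartition n B x := by
  have hlt : ∀ i, σ i / (B + 1) < n := fun i =>
    div_lt_of_lt_ucasT ((Nat.lt_add_of_pos_right (hx i)).trans_le (hσ i))
  have hle : ∀ k : Fin n, ∑ i with σ i / (B + 1) = k, x i ≤ B := fun k =>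
    sum_block_le hσ hc k
  refine ⟨fun k => {i | σ i / (B + 1) = k}, fun i => ⟨⟨_, hlt i⟩, by simp, fun k hk => ?_⟩, ?_⟩
  · exact Fin.ext (Finset.mem_filter.mp hk).2.symm
  · have htotal : ∑ k : Fin n, ∑ i with σ i / (B + 1) = k, x i = ∑ _k : Fin n, B := by
      rw [Finset.sum_const, Finset.card_univ, Fintype.card_fin, smul_eq_mul, ← hsum,
        ← Finset.sum_fiberwise Finset.univ (fun i => (⟨_, hlt i⟩ : Fin n)) x]
      simp only [Fin.ext_iff]
    exact fun k => (Finset.sum_eq_sum_iff_of_le fun k _ => hle k).mp htotal k (Finset.mem_univ k)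

/-- `x` admits a 3-partition iff the associated UCAS instance admits a schedule
of carbon cost `0`. -/
theorem threePartition_iff_zero_cost_schedule
    (n B : ℕ) (hn : 0 < n) (hB : 0 < B) (x : Fin (3 * n) → ℕ)
    (hsum : ∑ i, x i = n * B)
    (hx : ∀ i, B < 4 * x i ∧ 2 * x i < B) :
    ThreePartition n B x ↔
      ∃ σ : Fin (3 * n) → ℕ, IsSchedule n B x σ ∧ carbonCost n B x σ = 0 := by
  refine ⟨ThreePartition.exists_schedule, fun ⟨σ, hσ, hc⟩ => ?_⟩
  exact threePartition_of_schedule hsum (fun i => by have := hx i; omega) hσ hc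
end

section
/- Assume EST(u) ≤ LST(u) for every task u ∈ V. Then for every task v ∈ V and every integer t with EST(v) ≤ t ≤ LST(v), there exists a feasible schedule σ meeting deadline T with σ(v) = t. (In particular, the slack s(v) = LST(v) − EST(v) exactly describes the range of admissible start times of v.) -/
/-!
If `EST ≤ LST` everywhere, then for every task `v` every start time
`t ∈ [EST v, LST v]` is realized by some feasible schedule meeting deadline `T`:
the slack `LST v - EST v` exactly describes the admissible start times of `v`.
-/

/-- A schedule is feasible if it respects every precedence constraint. -/
def FeasibleW {V : Type*} (ω : V → ℕ) (Edge : V → V → Prop) (σ : V → ℕ) : Prop :=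
  ∀ u v, Edge u v → σ u + ω u ≤ σ v

/-- σ meets the deadline `T` if every task completes by time `T`. -/
def MeetsDeadline {V : Type*} (ω : V → ℕ) (T : ℕ) (σ : V → ℕ) : Prop :=
  ∀ v, σ v + ω v ≤ T

/-- `EST` is the earliest-start-time function: the unique function with
`EST v = max over edges (u, v) of (EST u + ω u)`, the max over ∅ being `0`. -/
def IsEST {V : Type*} (ω : V → ℕ) (Edge : V → V → Prop) (EST : V → ℕ) : Prop :=
  ∀ v, EST v = sSup (insert 0 {x | ∃ u, Edge u v ∧ x = EST u + ω u})

/-- `LST` is the latest-start-time function for deadline `T`: the unique function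
with `LST v = min (T - ω v) (min over edges (v, w) of (LST w - ω v))`, the inner
min being omitted when `v` has no successor. -/
def IsLST {V : Type*} (ω : V → ℕ) (Edge : V → V → Prop) (T : ℕ) (LST : V → ℤ) : Prop :=
  ∀ v, LST v = sInf (insert ((T : ℤ) - ω v) {x | ∃ w, Edge v w ∧ x = LST w - ω v})

theorem IsEST.add_le {V : Type*} [Finite V] {ω : V → ℕ} {Edge : V → V → Prop} {EST : V → ℕ}
    (h : IsEST ω Edge EST) {u v : V} (huv : Edge u v) : EST u + ω u ≤ EST v := by
  rw [h v]
  refine le_csSup (Set.Finite.bddAbove ?_) (Or.inr ⟨u, huv, rfl⟩)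
  refine ((Set.finite_range fun u => EST u + ω u).subset ?_).insert 0
  rintro x ⟨w, -, rfl⟩
  exact ⟨w, rfl⟩

theorem IsLST.bddBelow {V : Type*} [Finite V] (ω : V → ℕ) (Edge : V → V → Prop) (T : ℕ)
    (LST : V → ℤ) (v : V) :
    BddBelow (insert ((T : ℤ) - ω v) {x | ∃ w, Edge v w ∧ x = LST w - ω v}) := by
  refine Set.Finite.bddBelow (((Set.finite_range fun w => LST w - ω v).subset ?_).insert _)
  rintro x ⟨w, -, rfl⟩
  exact ⟨w, rfl⟩

theorem IsLST.add_le {V : Type*} [Finite V] {ω : V → ℕ} {Edge : V → V → Prop} {T : ℕ}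
    {LST : V → ℤ} (h : IsLST ω Edge T LST) {v w : V} (hvw : Edge v w) :
    LST v + ω v ≤ LST w := by
  have := csInf_le (IsLST.bddBelow ω Edge T LST v) (Or.inr ⟨w, hvw, rfl⟩)
  rw [← h v] at this
  omega

theorem IsLST.add_le_deadline {V : Type*} [Finite V] {ω : V → ℕ} {Edge : V → V → Prop} {T : ℕ}
    {LST : V → ℤ} (h : IsLST ω Edge T LST) (v : V) : LST v + ω v ≤ T := by
  have := csInf_le (IsLST.bddBelow ω Edge T LST v) (Set.mem_insert _ _)
  rw [← h v] at this
  omega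

/-- For every task `v` and every `t` with `EST v ≤ t ≤ LST v` there is a feasible
schedule meeting deadline `T` that starts `v` exactly at time `t`. -/
theorem exists_schedule_with_start_time
    {V : Type*} [Fintype V] (ω : V → ℕ) (hω : ∀ v, 0 < ω v)
    (Edge : V → V → Prop) (hacyc : ∀ v, ¬ Relation.TransGen Edge v v)
    (T : ℕ) (EST : V → ℕ) (hEST : IsEST ω Edge EST)
    (LST : V → ℤ) (hLST : IsLST ω Edge T LST)
    (hslack : ∀ u, (EST u : ℤ) ≤ LST u) :
    ∀ v : V, ∀ t : ℕ, EST v ≤ t → (t : ℤ) ≤ LST v →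
      ∃ σ : V → ℕ, FeasibleW ω Edge σ ∧ MeetsDeadline ω T σ ∧ σ v = t := by
  intro v t hEv hLv
  -- The shifted earliest schedule, capped by the latest one.
  refine ⟨fun u => min (LST u).toNat (EST u + (t - EST v)), fun u w huw => ?_, fun u => ?_, ?_⟩
  · have := hEST.add_le huw
    have := hLST.add_le huw
    have := hslack u
    dsimp only
    omega
  · have := hLST.add_le_deadline u
    have := hslack u
    dsimp only
    omega
  · dsimp only
    omega
end

section
/- Let γ, G ∈ ℕ, let ε be a real number with 0 < ε < 1, and let M ∈ ℕ with M ≥ γ + G + 1. Then an integer bu and a binary α ∈ {0,1} satisfy the six Big-M constraints bu ≥ 0, bu ≥ γ − G, bu ≤ γ − G + M(1 − α), bu ≤ Mα, γ − G ≤ Mα, and γ − G ≥ ε − M(1 − α) (inequalities over the reals, with γ − G computed in ℤ) if and only if bu = max(γ − G, 0) and α = 1 exactly when γ > G. In particular the Big-M encoding of the brown-power usage in the ILP is correct. -/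
/-!
Correctness of the Big-M encoding of the brown-power usage in the ILP:
for natural numbers `γ` (overall power usage) and `G` (green budget), a real
`0 < ε < 1` and a natural `M ≥ γ + G + 1`, an integer `bu` and a binary `α`
satisfy the six Big-M constraints iff `bu = max (γ - G) 0` and `α = 1`
exactly when `γ > G`.
-/

theorem bigM_encoding_correct
    (γ G : ℕ) (ε : ℝ) (hε0 : 0 < ε) (hε1 : ε < 1)
    (M : ℕ) (hM : γ + G + 1 ≤ M)
    (bu α : ℤ) (hα : α = 0 ∨ α = 1) :
    ((0 : ℝ) ≤ (bu : ℝ) ∧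
     ((((γ : ℤ) - (G : ℤ) : ℤ)) : ℝ) ≤ (bu : ℝ) ∧
     (bu : ℝ) ≤ ((((γ : ℤ) - (G : ℤ) : ℤ)) : ℝ) + (M : ℝ) * (1 - (α : ℝ)) ∧
     (bu : ℝ) ≤ (M : ℝ) * (α : ℝ) ∧
     ((((γ : ℤ) - (G : ℤ) : ℤ)) : ℝ) ≤ (M : ℝ) * (α : ℝ) ∧
     ε - (M : ℝ) * (1 - (α : ℝ)) ≤ ((((γ : ℤ) - (G : ℤ) : ℤ)) : ℝ)) ↔
    (bu = max ((γ : ℤ) - (G : ℤ)) 0 ∧ (α = 1 ↔ G < γ)) := by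
  have hMr : (γ : ℝ) + G + 1 ≤ M := by exact_mod_cast hM
  have hγ : (0 : ℝ) ≤ γ := γ.cast_nonneg
  have hG : (0 : ℝ) ≤ G := G.cast_nonneg
  rcases hα with rfl | rfl
  · constructor
    · rintro ⟨h1, -, -, h4, h5, -⟩
      have hbu : 0 ≤ bu := by exact_mod_cast h1
      have hbu' : bu ≤ 0 := by
        have : (bu : ℝ) ≤ 0 := by simpa using h4
        exact_mod_cast this
      have hd : (γ : ℤ) - G ≤ 0 := by
        have : (((γ : ℤ) - (G : ℤ) : ℤ) : ℝ) ≤ 0 := by simpa using h5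
        exact_mod_cast this
      omega
    · rintro ⟨h1, h2⟩
      have hle : γ ≤ G := by omega
      obtain rfl : bu = 0 := by omega
      have hler : (γ : ℝ) ≤ G := by exact_mod_cast hle
      push_cast
      refine ⟨?_, ?_, ?_, ?_, ?_, ?_⟩ <;> linarith
  · constructor
    · rintro ⟨-, h2, h3, -, -, h6⟩
      have hbu : (γ : ℤ) - G ≤ bu := by exact_mod_cast h2
      have hbu' : bu ≤ (γ : ℤ) - G := by
        have : (bu : ℝ) ≤ (((γ : ℤ) - (G : ℤ) : ℤ) : ℝ) := by simpa using h3
        exact_mod_cast this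
      have hd : 0 < (γ : ℤ) - G := by
        have : (0 : ℝ) < (((γ : ℤ) - (G : ℤ) : ℤ) : ℝ) := by
          refine hε0.trans_le ?_
          simpa using h6
        exact_mod_cast this
      omega
    · rintro ⟨h1, h2⟩
      have hlt : G + 1 ≤ γ := by omega
      obtain rfl : bu = (γ : ℤ) - G := by omega
      have hltr : (G : ℝ) + 1 ≤ γ := by exact_mod_cast hlt
      push_cast
      refine ⟨?_, ?_, ?_, ?_, ?_, ?_⟩ <;> linarith
end
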